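/- In the simple-interest model: for any x > 0, if θ(m) = 0 and t ↦ m(t) is nondecreasing, then the strategy α* of the compound-interest theorem — namely α*(t) := M(t)·1_{[0,t_c]}(t) + m(t)·1_{(t_c,T]}(t) if x > x*, and α*(t) := M(t) for all t if x ≤ x* — attains the infimum defining v(x), i.e. J(x, α*) = v(x). -/

import Mathlib

open MeasureTheory Set

noncomputable section

/-- Admissible repayment strategies: measurable, with `m t ≤ α t ≤ M t` on `[0,T]`. -/
def Adm (T : ℝ) (m M : ℝ → ℝ) : Set (ℝ → ℝ) :=
  {α | Measurable α ∧ ∀ t ∈ Icc (0:ℝ) T, m t ≤ α t ∧ α t ≤ M t}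

/-- Compound-interest balance. -/
def balC (r β x : ℝ) (α : ℝ → ℝ) (t : ℝ) : ℝ :=
  Real.exp ((r + β) * t) * (x - ∫ s in (0:ℝ)..t, Real.exp (-(r + β) * s) * α s)

/-- Terminal time: first zero of the balance in `[0,T]`, capped at `T`. -/
def tauC (r β T x : ℝ) (α : ℝ → ℝ) : ℝ :=
  sInf (insert T {t | t ∈ Icc (0:ℝ) T ∧ balC r β x α t = 0})

/-- Repayment cost. -/
def costC (r β T ω x : ℝ) (α : ℝ → ℝ) : ℝ :=
  (∫ t in (0:ℝ)..(tauC r β T x α), Real.exp (-r * t) * α t)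
    + ω * Real.exp (-r * tauC r β T x α) * balC r β x α (tauC r β T x α)

/-- Value function. -/
def valC (r β T ω : ℝ) (m M : ℝ → ℝ) (x : ℝ) : ℝ :=
  sInf (costC r β T ω x '' Adm T m M)

/-- Critical horizon `t_c = max(T + log ω / β, 0)`. -/
def tCrit (β T ω : ℝ) : ℝ := max (T + Real.log ω / β) 0

/-- The cost `v₁` of the max-min strategy. -/
def vOne (r β T ω : ℝ) (m M : ℝ → ℝ) (x : ℝ) : ℝ :=
  (∫ s in (0:ℝ)..(tCrit β T ω), Real.exp (-r * s) * M s)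
  + (∫ s in (tCrit β T ω)..T, Real.exp (-r * s) * m s)
  + ω * Real.exp (β * T) *
    (x - (∫ s in (0:ℝ)..(tCrit β T ω), Real.exp (-(r + β) * s) * M s)
       - ∫ s in (tCrit β T ω)..T, Real.exp (-(r + β) * s) * m s)

/-- `x̂ = ∫_0^{t_c} e^{-(r+β)s} M(s) ds`. -/
def xHat (r β T ω : ℝ) (M : ℝ → ℝ) : ℝ :=
  ∫ s in (0:ℝ)..(tCrit β T ω), Real.exp (-(r + β) * s) * M s

/-- `x̄ = ∫_0^T e^{-(r+β)s} M(s) ds`. -/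
def xBar (r β T : ℝ) (M : ℝ → ℝ) : ℝ :=
  ∫ s in (0:ℝ)..T, Real.exp (-(r + β) * s) * M s

/-- `x̲ = ∫_0^T e^{-(r+β)s} m(s) ds`. -/
def xLow (r β T : ℝ) (m : ℝ → ℝ) : ℝ :=
  ∫ s in (0:ℝ)..T, Real.exp (-(r + β) * s) * m s

/-- `x_c = ∫_0^{t_c} e^{-(r+β)s} M(s) ds + ∫_{t_c}^T e^{-(r+β)s} m(s) ds`. -/
def xCrit (r β T ω : ℝ) (m M : ℝ → ℝ) : ℝ :=
  xHat r β T ω M + ∫ s in (tCrit β T ω)..T, Real.exp (-(r + β) * s) * m s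
/-- Running infimum of the balance: the principal. -/
def runInf (b : ℝ → ℝ) (t : ℝ) : ℝ := sInf (b '' Icc (0:ℝ) t)

/-- The simple-interest balance equation: `b` is continuous on `[0,T]`,
`b_t = x + ∫_0^t ((r+β) p_s − α_s) ds`, with `p` the running infimum of `b`. -/
def SimpleBal (r β T x : ℝ) (α b : ℝ → ℝ) : Prop :=
  ContinuousOn b (Icc (0:ℝ) T) ∧
  ∀ t ∈ Icc (0:ℝ) T, b t = x + ∫ s in (0:ℝ)..t, ((r + β) * runInf b s - α s)

/-- First time of principal repayment, with `inf ∅ = T`. -/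
def thetaS (T x : ℝ) (b : ℝ → ℝ) : ℝ :=
  sInf (insert T {t | t ∈ Icc (0:ℝ) T ∧ runInf b t < x})

/-- Terminal time in the simple-interest model. -/
def tauS (T : ℝ) (b : ℝ → ℝ) : ℝ :=
  sInf (insert T {t | t ∈ Icc (0:ℝ) T ∧ b t = 0})

/-- Repayment cost in the simple-interest model. -/
def costS (r T ω : ℝ) (α b : ℝ → ℝ) : ℝ :=
  (∫ t in (0:ℝ)..(tauS T b), Real.exp (-r * t) * α t)
    + ω * Real.exp (-r * tauS T b) * b (tauS T b)

/-- The repayment rate `α` discounted at rate `k`. -/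
def discounted (k : ℝ) (α : ℝ → ℝ) (s : ℝ) : ℝ := Real.exp (-k * s) * α s

/-- Marginal cost, relative to repaying nothing before `T`, of one unit of repayment at time `s`
discounted at rate `r + β`. -/
def marginalCost (β T ω s : ℝ) : ℝ := Real.exp (β * s) - ω * Real.exp (β * T)

lemma continuous_marginalCost (β T ω : ℝ) : Continuous (marginalCost β T ω) := by
  unfold marginalCost
  fun_prop

lemma monotone_marginalCost {β : ℝ} (hβ : 0 < β) (T ω : ℝ) : Monotone (marginalCost β T ω) := by
  intro s t hst
  unfold marginalCost
  gcongr

lemma marginalCost_pos {β T ω t : ℝ} (hβ : 0 < β) (hω : 0 < ω) (ht : tCrit β T ω < t) :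
    0 < marginalCost β T ω t := by
  have h1 : T + Real.log ω / β < t := (le_max_left _ _).trans_lt ht
  have h2 : Real.log ω + β * T < β * t := by
    have := mul_lt_mul_of_pos_left h1 hβ
    rwa [mul_add, mul_div_cancel₀ _ hβ.ne', add_comm] at this
  have h3 := Real.exp_lt_exp.2 h2
  rw [Real.exp_add, Real.exp_log hω] at h3
  exact sub_pos.2 h3

lemma marginalCost_nonneg {β T ω t : ℝ} (hβ : 0 < β) (hω : 0 < ω) (ht : tCrit β T ω ≤ t) :
    0 ≤ marginalCost β T ω t := by
  rcases ht.eq_or_lt with rfl | ht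
  · exact ge_of_tendsto ((continuous_marginalCost β T ω).continuousWithinAt
      (s := Ioi (tCrit β T ω)) (x := tCrit β T ω)).tendsto
      (eventually_mem_nhdsWithin.mono fun s hs => (marginalCost_pos hβ hω hs).le)
  · exact (marginalCost_pos hβ hω ht).le

lemma marginalCost_nonpos {β T ω t : ℝ} (hβ : 0 < β) (hω : 0 < ω) (h0 : 0 ≤ t)
    (ht : t < tCrit β T ω) : marginalCost β T ω t ≤ 0 := by
  have h1 : t < T + Real.log ω / β := (lt_max_iff.1 ht).resolve_right h0.not_gt
  have h2 : β * t < Real.log ω + β * T := by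
    have := mul_lt_mul_of_pos_left h1 hβ
    rwa [mul_add, mul_div_cancel₀ _ hβ.ne', add_comm] at this
  have h3 := Real.exp_lt_exp.2 h2
  rw [Real.exp_add, Real.exp_log hω] at h3
  exact (sub_neg.2 h3).le

lemma intervalIntegrable_discounted {k a b : ℝ} {α : ℝ → ℝ} (h : IntervalIntegrable α volume a b) :
    IntervalIntegrable (discounted k α) volume a b :=
  h.continuousOn_mul (by fun_prop)

lemma discounted_mono {k s : ℝ} {α γ : ℝ → ℝ} (h : α s ≤ γ s) :
    discounted k α s ≤ discounted k γ s :=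
  mul_le_mul_of_nonneg_left h (Real.exp_pos _).le

lemma discounted_nonneg {k s : ℝ} {α : ℝ → ℝ} (h : 0 ≤ α s) : 0 ≤ discounted k α s :=
  mul_nonneg (Real.exp_pos _).le h

lemma marginalCost_mul_discounted (r β T ω s : ℝ) (α : ℝ → ℝ) :
    Real.exp (-r * s) * α s * (1 - ω * Real.exp (β * (T - s)))
      = marginalCost β T ω s * discounted (r + β) α s := by
  have h1 : Real.exp (-r * s) = Real.exp (β * s) * Real.exp (-(r + β) * s) := by
    rw [← Real.exp_add]; ring_nf
  have h2 : Real.exp (β * T) = Real.exp (β * s) * Real.exp (β * (T - s)) := by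
    rw [← Real.exp_add]; ring_nf
  rw [marginalCost, discounted, h1, h2]
  ring

/-- With an increasing weight `h`, it is cheapest to place mass as early as possible. -/
lemma rearrangement_le {h f N : ℝ → ℝ} {a σ τ : ℝ} (haσ : a ≤ σ) (hστ : σ ≤ τ)
    (hmon : Monotone h) (hcont : Continuous h)
    (hf : IntervalIntegrable f volume a τ) (hN : IntervalIntegrable N volume a τ)
    (hf0 : ∀ s ∈ Icc a τ, 0 ≤ f s) (hfN : ∀ s ∈ Icc a τ, f s ≤ N s) :
    h σ * ((∫ s in a..τ, f s) - ∫ s in a..σ, N s)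
      ≤ (∫ s in a..τ, h s * f s) - ∫ s in a..σ, h s * N s := by
  have hσ : σ ∈ uIcc a τ := by rw [uIcc_of_le (haσ.trans hστ)]; exact ⟨haσ, hστ⟩
  have hf1 : IntervalIntegrable f volume a σ := hf.mono_set (uIcc_subset_uIcc_left hσ)
  have hf2 : IntervalIntegrable f volume σ τ := hf.mono_set (uIcc_subset_uIcc_right hσ)
  have hN1 : IntervalIntegrable N volume a σ := hN.mono_set (uIcc_subset_uIcc_left hσ)
  have hhf1 := hf1.continuousOn_mul (hcont.continuousOn (s := uIcc a σ))
  have hhf2 := hf2.continuousOn_mul (hcont.continuousOn (s := uIcc σ τ))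
  have hhN1 := hN1.continuousOn_mul (hcont.continuousOn (s := uIcc a σ))
  have e1 : (∫ s in a..σ, h σ * (f s - N s)) ≤ ∫ s in a..σ, (h s * f s - h s * N s) := by
    refine intervalIntegral.integral_mono_on haσ ((hf1.sub hN1).const_mul _) (hhf1.sub hhN1) ?_
    intro s hs
    have := hmon hs.2
    have := hfN s ⟨hs.1, hs.2.trans hστ⟩
    nlinarith
  have e2 : (∫ s in σ..τ, h σ * f s) ≤ ∫ s in σ..τ, h s * f s := by
    refine intervalIntegral.integral_mono_on hστ (hf2.const_mul _) hhf2 ?_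
    intro s hs
    exact mul_le_mul_of_nonneg_right (hmon hs.1) (hf0 s ⟨haσ.trans hs.1, hs.2⟩)
  rw [intervalIntegral.integral_const_mul, intervalIntegral.integral_sub hf1 hN1,
    intervalIntegral.integral_sub hhf1 hhN1] at e1
  rw [intervalIntegral.integral_const_mul] at e2
  rw [← intervalIntegral.integral_add_adjacent_intervals hf1 hf2,
    ← intervalIntegral.integral_add_adjacent_intervals hhf1 hhf2]
  linarith

/-- A solution of the linear equation `b' = k b - α`, `b 0 = x`, in discounted form. -/
lemma exp_mul_eq_sub_integral_discounted {k T x : ℝ} {α b : ℝ → ℝ}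
    (hα : IntervalIntegrable α volume 0 T) (hb : ContinuousOn b (Icc 0 T))
    (heq : ∀ t ∈ Icc 0 T, b t = x + ∫ s in (0:ℝ)..t, (k * b s - α s)) {t : ℝ}
    (ht : t ∈ Icc 0 T) :
    Real.exp (-k * t) * b t = x - ∫ s in (0:ℝ)..t, discounted k α s := by
  have hsub : Icc 0 t ⊆ Icc 0 T := Icc_subset_Icc_right ht.2
  have hu : uIcc 0 t = Icc 0 t := uIcc_of_le ht.1
  have hα' : IntervalIntegrable α volume 0 t := by
    refine hα.mono_set ?_
    rw [hu, uIcc_of_le (ht.1.trans ht.2)]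
    exact hsub
  have hbi : IntervalIntegrable b volume 0 t :=
    (hb.mono (hu ▸ hsub)).intervalIntegrable
  have hg : IntervalIntegrable (fun s => k * b s - α s) volume 0 t := (hbi.const_mul k).sub hα'
  have hI : AbsolutelyContinuousOnInterval
      (fun u => ∫ s in (0:ℝ)..u, (k * b s - α s)) 0 t :=
    hg.absolutelyContinuousOnInterval_intervalIntegral (by simp)
  have hE : AbsolutelyContinuousOnInterval (fun u => Real.exp (-k * u)) 0 t :=
    (ContDiff.contDiffOn (by fun_prop) : ContDiffOn ℝ 1 (fun u => Real.exp (-k * u))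
      (uIcc 0 t)).absolutelyContinuousOnInterval
  have hc : AbsolutelyContinuousOnInterval (fun _ : ℝ => x) 0 t :=
    (contDiffOn_const : ContDiffOn ℝ 1 (fun _ : ℝ => x)
      (uIcc 0 t)).absolutelyContinuousOnInterval
  have key := (hE.fun_mul (hc.fun_add hI)).integral_deriv_eq_sub
  have hd : ∫ u in (0:ℝ)..t, deriv (fun u => Real.exp (-k * u)
      * (x + ∫ s in (0:ℝ)..u, (k * b s - α s))) u = ∫ u in (0:ℝ)..t, -discounted k α u := by
    apply intervalIntegral.integral_congr_ae
    filter_upwards [hg.ae_hasDerivAt_integral] with u hu1 hu2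
    have hu3 : u ∈ uIcc 0 t := uIoc_subset_uIcc hu2
    have h1 := (hu1 hu3 0 (by simp)).const_add x
    have h2 : HasDerivAt (fun u => Real.exp (-k * u)) (Real.exp (-k * u) * (-k)) u := by
      simpa using ((hasDerivAt_id u).const_mul (-k)).exp
    have h3 := (h2.fun_mul h1).deriv
    rw [h3, ← heq u (hsub (hu ▸ hu3)), discounted]
    ring
  rw [hd, intervalIntegral.integral_neg, ← heq t ht] at key
  simp at key
  simp
  linarith

lemma bddBelow_image_Icc {b : ℝ → ℝ} {t T : ℝ} (hb : ContinuousOn b (Icc 0 T)) (ht : t ≤ T) :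
    BddBelow (b '' Icc 0 t) :=
  (isCompact_Icc.image_of_continuousOn (hb.mono (Icc_subset_Icc_right ht))).bddBelow

lemma SimpleBal.apply_zero {r β T x : ℝ} {α b : ℝ → ℝ} (hT : 0 ≤ T)
    (h : SimpleBal r β T x α b) : b 0 = x := by
  have := h.2 0 ⟨le_rfl, hT⟩
  simpa using this

lemma antitoneOn_runInf {b : ℝ → ℝ} {T : ℝ} (hb : ContinuousOn b (Icc 0 T)) :
    AntitoneOn (runInf b) (Icc 0 T) := by
  intro s hs t ht hst
  exact csInf_le_csInf (bddBelow_image_Icc hb ht.2) ((nonempty_Icc.2 hs.1).image b)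
    (image_mono (Icc_subset_Icc_right hst))

/-- If every admissible payment exceeds the interest on `x`, the balance is nonincreasing, so
that principal and balance coincide. -/
lemma SimpleBal.runInf_eq {r β T x : ℝ} {α b : ℝ → ℝ} (hk : 0 < r + β) (hT : 0 ≤ T)
    (h : SimpleBal r β T x α b) (hα : IntervalIntegrable α volume 0 T)
    (hαx : ∀ t ∈ Ioc 0 T, (r + β) * x ≤ α t) {t : ℝ} (ht : t ∈ Icc 0 T) : runInf b t = b t := by
  have hb0 := h.apply_zero hT
  have hp : ∀ s ∈ Icc 0 T, runInf b s ≤ x := fun s hs =>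
    hb0 ▸ csInf_le (bddBelow_image_Icc h.1 hs.2) ⟨0, ⟨le_rfl, hs.1⟩, rfl⟩
  have hpi : IntervalIntegrable (runInf b) volume 0 T := by
    refine AntitoneOn.intervalIntegrable ?_
    rw [uIcc_of_le hT]
    exact antitoneOn_runInf h.1
  have hg : IntervalIntegrable (fun s => (r + β) * runInf b s - α s) volume 0 T :=
    (hpi.const_mul _).sub hα
  have hanti : AntitoneOn b (Icc 0 T) := by
    intro s hs t ht hst
    have hs' : s ∈ uIcc 0 T := by rwa [uIcc_of_le hT]
    have ht' : t ∈ uIcc 0 T := by rwa [uIcc_of_le hT]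
    have h1 : IntervalIntegrable (fun s => (r + β) * runInf b s - α s) volume 0 s :=
      hg.mono_set (uIcc_subset_uIcc_left hs')
    have h2 : IntervalIntegrable (fun s => (r + β) * runInf b s - α s) volume s t :=
      hg.mono_set (uIcc_subset_uIcc hs' ht')
    rw [h.2 s hs, h.2 t ht, ← intervalIntegral.integral_add_adjacent_intervals h1 h2]
    have : ∫ u in s..t, ((r + β) * runInf b u - α u) ≤ ∫ u in s..t, (0 : ℝ) := by
      refine intervalIntegral.integral_mono_on_of_le_Ioo hst h2 (by simp) ?_
      intro u hu
      have hu0 : 0 < u := hs.1.trans_lt hu.1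
      have huT : u ≤ T := hu.2.le.trans ht.2
      have := mul_le_mul_of_nonneg_left (hp u ⟨hu0.le, huT⟩) hk.le
      have := hαx u ⟨hu0, huT⟩
      linarith
    simp at this
    linarith
  refine IsLeast.csInf_eq ⟨⟨t, ⟨ht.1, le_rfl⟩, rfl⟩, ?_⟩
  rintro _ ⟨s, hs, rfl⟩
  exact hanti ⟨hs.1, hs.2.trans ht.2⟩ ht hs.2

/-- If the principal is repaid immediately under a nondecreasing strategy `m`, then `m` exceeds
the interest on `x`. -/
lemma interest_le_of_thetaS_eq_zero {r β T x : ℝ} {m b : ℝ → ℝ} (hk : 0 < r + β) (hT : 0 < T)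
    (h : SimpleBal r β T x m b) (hm : IntervalIntegrable m volume 0 T)
    (hmono : MonotoneOn m (Icc 0 T)) (hθ : thetaS T x b = 0) :
    ∀ t ∈ Ioc 0 T, (r + β) * x ≤ m t := by
  intro t₀ ht₀
  by_contra! hlt
  have hb0 := h.apply_zero hT.le
  have hlt' : m t₀ / (r + β) < b 0 := by rw [hb0, div_lt_iff₀ hk]; linarith
  have hev : ∀ᶠ s in nhdsWithin 0 (Icc 0 T), m t₀ / (r + β) < b s :=
    (h.1 0 ⟨le_rfl, hT.le⟩).tendsto.eventually_const_lt hlt'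
  obtain ⟨ε, hε, hball⟩ := Metric.mem_nhdsWithin_iff.1 hev
  obtain ⟨δ, hδ0, hδ⟩ : ∃ δ, 0 < δ ∧ δ < ε ∧ δ ≤ t₀ :=
    ⟨min (ε / 2) t₀, lt_min (by linarith) ht₀.1, (min_le_left _ _).trans_lt (by linarith),
      min_le_right _ _⟩
  have hδT : δ ≤ T := hδ.2.trans ht₀.2
  have hbs : ∀ s ∈ Icc 0 δ, m t₀ / (r + β) ≤ b s := fun s hs =>
    (hball ⟨by
      rw [Metric.mem_ball, Real.dist_eq, sub_zero, abs_of_nonneg hs.1]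
      exact hs.2.trans_lt hδ.1, hs.1, hs.2.trans hδT⟩ : m t₀ / (r + β) < b s).le
  have hps : ∀ s ∈ Icc 0 δ, m s ≤ (r + β) * runInf b s := by
    intro s hs
    have h1 : m t₀ / (r + β) ≤ runInf b s := by
      refine le_csInf ((nonempty_Icc.2 hs.1).image b) ?_
      rintro _ ⟨u, hu, rfl⟩
      exact hbs u ⟨hu.1, hu.2.trans hs.2⟩
    rw [div_le_iff₀ hk] at h1
    have h2 := hmono ⟨hs.1, hs.2.trans hδT⟩ ⟨ht₀.1.le, ht₀.2⟩ (hs.2.trans hδ.2)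
    linarith
  have hbx : ∀ s ∈ Icc 0 δ, x ≤ b s := by
    intro s hs
    rw [h.2 s ⟨hs.1, hs.2.trans hδT⟩]
    have : 0 ≤ ∫ u in (0:ℝ)..s, ((r + β) * runInf b u - m u) :=
      intervalIntegral.integral_nonneg hs.1 fun u hu =>
        sub_nonneg.2 (hps u ⟨hu.1, hu.2.trans hs.2⟩)
    linarith
  have : δ ≤ thetaS T x b := by
    refine le_csInf (insert_nonempty _ _) ?_
    rintro t (rfl | ⟨ht, hlt⟩)
    · exact hδT
    · by_contra! htδ
      refine hlt.not_ge (le_csInf ((nonempty_Icc.2 ht.1).image b) ?_)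
      rintro _ ⟨u, hu, rfl⟩
      exact hbx u ⟨hu.1, hu.2.trans htδ.le⟩
  linarith

section Terminal

variable {T : ℝ} {b : ℝ → ℝ}

/-- The terminal time is `T` or a zero of the balance in `[0,T]`. -/
lemma tauS_mem (hT : 0 ≤ T) (hb : ContinuousOn b (Icc 0 T)) :
    tauS T b ∈ Icc 0 T ∧ (tauS T b = T ∨ b (tauS T b) = 0) := by
  have hclosed : IsClosed {t | t ∈ Icc (0:ℝ) T ∧ b t = 0} :=
    hb.preimage_isClosed_of_isClosed isClosed_Icc isClosed_singleton
  have hmem : tauS T b ∈ insert T {t | t ∈ Icc (0:ℝ) T ∧ b t = 0} := by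
    refine IsClosed.csInf_mem ?_ (insert_nonempty _ _) ⟨0, ?_⟩
    · rw [insert_eq]
      exact isClosed_singleton.union hclosed
    · rintro t (rfl | ht)
      exacts [hT, ht.1.1]
  rcases hmem with h | h
  · exact ⟨h.symm ▸ right_mem_Icc.2 hT, Or.inl h⟩
  · exact ⟨h.1, Or.inr h.2⟩

lemma tauS_le_of_nonpos (hT : 0 ≤ T) (hb : ContinuousOn b (Icc 0 T)) (h0 : 0 ≤ b 0) {t : ℝ}
    (ht : t ∈ Icc 0 T) (hbt : b t ≤ 0) : tauS T b ≤ t := by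
  obtain ⟨s, hs, hs0⟩ := intermediate_value_Icc' ht.1 (hb.mono (Icc_subset_Icc_right ht.2))
    ⟨hbt, h0⟩
  have hbdd : BddBelow (insert T {t | t ∈ Icc (0:ℝ) T ∧ b t = 0}) := by
    refine ⟨0, ?_⟩
    rintro u (rfl | hu)
    exacts [hT, hu.1.1]
  exact (csInf_le hbdd (Or.inr ⟨⟨hs.1, hs.2.trans ht.2⟩, hs0⟩)).trans hs.2

lemma nonneg_apply_tauS (hT : 0 ≤ T) (hb : ContinuousOn b (Icc 0 T)) (h0 : 0 ≤ b 0) :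
    0 ≤ b (tauS T b) := by
  obtain ⟨hmem, h | h⟩ := tauS_mem hT hb
  · by_contra! hlt
    obtain ⟨s, hs, hs0⟩ := intermediate_value_Icc' hmem.1 (hb.mono (Icc_subset_Icc_right hmem.2))
      ⟨hlt.le, h0⟩
    have hle := tauS_le_of_nonpos hT hb h0 ⟨hs.1, hs.2.trans hmem.2⟩ hs0.le
    rw [le_antisymm hle hs.2, hs0] at hlt
    exact lt_irrefl _ hlt
  · exact h.ge

end Terminal

/-- What optimality needs to know about a strategy `α` with cost `J` and terminal time `τ`. -/
structure CostRepr (r β T ω x : ℝ) (α : ℝ → ℝ) (τ J : ℝ) : Prop where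
  mem : τ ∈ Icc 0 T
  le : (∫ s in (0:ℝ)..τ, discounted (r + β) α s) ≤ x
  eq_or : τ = T ∨ (∫ s in (0:ℝ)..τ, discounted (r + β) α s) = x
  le_of : ∀ t ∈ Icc 0 T, x ≤ (∫ s in (0:ℝ)..t, discounted (r + β) α s) → τ ≤ t
  cost : J = ω * Real.exp (β * T) * x
    + ∫ s in (0:ℝ)..τ, marginalCost β T ω s * discounted (r + β) α s

lemma costRepr_costS {r β T ω x : ℝ} {α b : ℝ → ℝ} (hk : 0 < r + β) (hT : 0 ≤ T) (hx : 0 ≤ x)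
    (h : SimpleBal r β T x α b) (hα : IntervalIntegrable α volume 0 T)
    (hαx : ∀ t ∈ Ioc 0 T, (r + β) * x ≤ α t) :
    CostRepr r β T ω x α (tauS T b) (costS r T ω α b) := by
  have hode : ∀ t ∈ Icc 0 T, b t = x + ∫ s in (0:ℝ)..t, ((r + β) * b s - α s) := by
    intro t ht
    rw [h.2 t ht]
    congr 1
    refine intervalIntegral.integral_congr fun s hs => ?_
    rw [uIcc_of_le ht.1] at hs
    simp only [h.runInf_eq hk hT hα hαx ⟨hs.1, hs.2.trans ht.2⟩]
  have hdisc : ∀ t ∈ Icc 0 T, Real.exp (-(r + β) * t) * b t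
      = x - ∫ s in (0:ℝ)..t, discounted (r + β) α s :=
    fun t ht => exp_mul_eq_sub_integral_discounted hα h.1 hode ht
  have hb0 : 0 ≤ b 0 := by rwa [h.apply_zero hT]
  obtain ⟨hmem, hor⟩ := tauS_mem hT h.1
  have hτ := hdisc _ hmem
  have hα' : IntervalIntegrable α volume 0 (tauS T b) :=
    hα.mono_set (uIcc_subset_uIcc_left (by rwa [uIcc_of_le hT]))
  refine ⟨hmem, ?_, hor.imp_right fun h0 => ?_, fun t ht hxt => ?_, ?_⟩
  · have := mul_nonneg (Real.exp_pos (-(r + β) * tauS T b)).le (nonneg_apply_tauS hT h.1 hb0)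
    linarith
  · rw [h0] at hτ
    linarith
  · refine tauS_le_of_nonpos hT h.1 hb0 ht ?_
    have := hdisc t ht
    exact nonpos_of_mul_nonpos_right (by linarith) (Real.exp_pos (-(r + β) * t))
  · have hterm : ω * Real.exp (-r * tauS T b) * b (tauS T b)
        = ω * Real.exp (β * T) * (x - ∫ s in (0:ℝ)..(tauS T b), discounted (r + β) α s) := by
      rcases hor with h1 | h0
      · rw [← hτ, h1, mul_assoc, mul_assoc, ← mul_assoc (Real.exp (β * T)), ← Real.exp_add]
        ring_nf
      · rw [← hτ, h0]
        ring
    have hint : (∫ t in (0:ℝ)..(tauS T b), Real.exp (-r * t) * α t)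
        = (∫ s in (0:ℝ)..(tauS T b), marginalCost β T ω s * discounted (r + β) α s)
          + ω * Real.exp (β * T) * ∫ s in (0:ℝ)..(tauS T b), discounted (r + β) α s := by
      rw [← intervalIntegral.integral_const_mul, ← intervalIntegral.integral_add]
      · refine intervalIntegral.integral_congr fun s _ => ?_
        have h1 : Real.exp (-r * s) = Real.exp (β * s) * Real.exp (-(r + β) * s) := by
          rw [← Real.exp_add]; ring_nf
        simp only [marginalCost, discounted, h1]
        ring
      · exact (intervalIntegrable_discounted hα').continuousOn_mul
          (continuous_marginalCost β T ω).continuousOn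
      · exact (intervalIntegrable_discounted hα').const_mul _
    rw [costS, hterm, hint]
    ring

/-- Without absorption the cheapest repayments are maximal before the critical horizon and
minimal after it. -/
lemma maxMin_le {k β T ω : ℝ} {m M α : ℝ → ℝ} (hβ : 0 < β) (hω : 0 < ω)
    (hc : tCrit β T ω ≤ T) (hm : IntervalIntegrable m volume 0 T)
    (hM : IntervalIntegrable M volume 0 T) (hα : IntervalIntegrable α volume 0 T)
    (hmα : ∀ t ∈ Icc 0 T, m t ≤ α t) (hαM : ∀ t ∈ Icc 0 T, α t ≤ M t) :
    (∫ s in (0:ℝ)..(tCrit β T ω), marginalCost β T ω s * discounted k M s)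
      + (∫ s in (tCrit β T ω)..T, marginalCost β T ω s * discounted k m s)
      ≤ ∫ s in (0:ℝ)..T, marginalCost β T ω s * discounted k α s := by
  have hc0 : 0 ≤ tCrit β T ω := le_max_right _ _
  have hmem : tCrit β T ω ∈ uIcc 0 T := by rw [uIcc_of_le (hc0.trans hc)]; exact ⟨hc0, hc⟩
  have hi : ∀ {γ : ℝ → ℝ}, IntervalIntegrable γ volume 0 T →
      IntervalIntegrable (fun s => marginalCost β T ω s * discounted k γ s) volume 0 T :=
    fun hγ => (intervalIntegrable_discounted hγ).continuousOn_mul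
      (continuous_marginalCost β T ω).continuousOn
  have hl : uIcc 0 (tCrit β T ω) ⊆ uIcc 0 T := uIcc_subset_uIcc_left hmem
  have hr : uIcc (tCrit β T ω) T ⊆ uIcc 0 T := uIcc_subset_uIcc_right hmem
  rw [← intervalIntegral.integral_add_adjacent_intervals
    ((hi hα).mono_set hl) ((hi hα).mono_set hr)]
  refine add_le_add ?_ ?_
  · refine intervalIntegral.integral_mono_on_of_le_Ioo hc0
      ((hi hM).mono_set hl) ((hi hα).mono_set hl) fun s hs => ?_
    exact mul_le_mul_of_nonpos_left (discounted_mono (hαM s ⟨hs.1.le, hs.2.le.trans hc⟩))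
      (marginalCost_nonpos hβ hω hs.1.le hs.2)
  · refine intervalIntegral.integral_mono_on hc
      ((hi hm).mono_set hr) ((hi hα).mono_set hr) fun s hs => ?_
    exact mul_le_mul_of_nonneg_left (discounted_mono (hmα s ⟨hc0.trans hs.1, hs.2⟩))
      (marginalCost_nonneg hβ hω hs.1)

/-- simple interest: if `θ(m) = 0` and `m` is nondecreasing,
the strategy of the compound-interest theorem (max-min if `x > x*`, max if
`x ≤ x*`) attains the infimum defining `v(x)` in the simple-interest model. -/
theorem stmt13 (r β T ω : ℝ) (m M : ℝ → ℝ)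
    (hr : 0 < r) (hβ : 0 < β) (hT : 0 < T) (hω : ω ∈ Ioo (0:ℝ) 1)
    (hmMeas : Measurable m) (hMMeas : Measurable M)
    (hmInt : IntegrableOn m (Icc (0:ℝ) T)) (hMInt : IntegrableOn M (Icc (0:ℝ) T))
    (hmM : ∀ t ∈ Icc (0:ℝ) T, 0 < m t ∧ m t < M t)
    (hmono : MonotoneOn m (Icc (0:ℝ) T))
    (tstar : ℝ) (htstar : tstar ∈ Ioo (tCrit β T ω) T)
    (htstarEq :
      (∫ s in (tCrit β T ω)..tstar,
        Real.exp (-r * s) * M s * (1 - ω * Real.exp (β * (T - s))))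
      = ∫ s in (tCrit β T ω)..T,
        Real.exp (-r * s) * m s * (1 - ω * Real.exp (β * (T - s))))
    (x : ℝ) (hx : 0 < x)
    (B : (ℝ → ℝ) → (ℝ → ℝ))
    (hB : ∀ α ∈ Adm T m M, SimpleBal r β T x α (B α))
    (hθm : thetaS T x (B m) = 0) :
    ((∫ s in (0:ℝ)..tstar, Real.exp (-(r + β) * s) * M s) < x →
      (fun t => if t ≤ tCrit β T ω then M t else m t) ∈ Adm T m M ∧
      costS r T ω (fun t => if t ≤ tCrit β T ω then M t else m t)
          (B (fun t => if t ≤ tCrit β T ω then M t else m t))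
        = sInf ((fun α => costS r T ω α (B α)) '' Adm T m M)) ∧
    (x ≤ (∫ s in (0:ℝ)..tstar, Real.exp (-(r + β) * s) * M s) →
      M ∈ Adm T m M ∧
      costS r T ω M (B M)
        = sInf ((fun α => costS r T ω α (B α)) '' Adm T m M)) := by
  have hω0 := hω.1
  have hk : 0 < r + β := by linarith
  set tc := tCrit β T ω with htc
  set h := marginalCost β T ω with hh
  have hc0 : 0 ≤ tc := le_max_right _ _
  have hcs : tc ≤ tstar := htstar.1.le
  have hs0 : 0 ≤ tstar := hc0.trans hcs
  have hsT : tstar ≤ T := htstar.2.le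
  have hcT : tc ≤ T := hcs.trans hsT
  have hmon : Monotone h := monotone_marginalCost hβ T ω
  have hcont : Continuous h := continuous_marginalCost β T ω
  have hmi : IntervalIntegrable m volume 0 T :=
    (intervalIntegrable_iff_integrableOn_Icc_of_le hT.le).2 hmInt
  have hMi : IntervalIntegrable M volume 0 T :=
    (intervalIntegrable_iff_integrableOn_Icc_of_le hT.le).2 hMInt
  have hαi : ∀ α ∈ Adm T m M, IntervalIntegrable α volume 0 T := by
    intro α hα
    refine hMi.mono_fun hα.1.aestronglyMeasurable ?_
    refine (ae_restrict_mem measurableSet_uIoc).mono fun t ht => ?_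
    rw [uIoc_of_le hT.le] at ht
    have h1 := hα.2 t ⟨ht.1.le, ht.2⟩
    have h2 := hmM t ⟨ht.1.le, ht.2⟩
    dsimp only
    rw [Real.norm_of_nonneg (h2.1.le.trans h1.1), Real.norm_of_nonneg (by linarith)]
    exact h1.2
  have hmA : m ∈ Adm T m M := ⟨hmMeas, fun t ht => ⟨le_rfl, (hmM t ht).2.le⟩⟩
  have hMA : M ∈ Adm T m M := ⟨hMMeas, fun t ht => ⟨(hmM t ht).2.le, le_rfl⟩⟩
  have haA : (fun t => if t ≤ tc then M t else m t) ∈ Adm T m M := by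
    refine ⟨Measurable.ite measurableSet_Iic hMMeas hmMeas, fun t ht => ?_⟩
    have := (hmM t ht).2.le
    dsimp only
    split_ifs
    exacts [⟨this, le_rfl⟩, ⟨le_rfl, this⟩]
  have hmx := interest_le_of_thetaS_eq_zero hk hT (hB m hmA) hmi hmono hθm
  have hrepr : ∀ α ∈ Adm T m M,
      CostRepr r β T ω x α (tauS T (B α)) (costS r T ω α (B α)) := fun α hα =>
    costRepr_costS hk hT.le hx.le (hB α hα) (hαi α hα)
      fun t ht => (hmx t ht).trans (hα.2 t ⟨ht.1.le, ht.2⟩).1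
  have hdi : ∀ α ∈ Adm T m M, ∀ s ∈ Icc 0 T, ∀ t ∈ Icc 0 T,
      IntervalIntegrable (discounted (r + β) α) volume s t := fun α hα s hs t ht =>
    (intervalIntegrable_discounted (hαi α hα)).mono_set
      (uIcc_subset_uIcc (by rwa [uIcc_of_le hT.le]) (by rwa [uIcc_of_le hT.le]))
  have hhi : ∀ α ∈ Adm T m M, ∀ s ∈ Icc 0 T, ∀ t ∈ Icc 0 T,
      IntervalIntegrable (fun s => h s * discounted (r + β) α s) volume s t :=
    fun α hα s hs t ht => (hdi α hα s hs t ht).continuousOn_mul hcont.continuousOn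
  have hpos : ∀ α ∈ Adm T m M, ∀ s ∈ Icc 0 T, 0 ≤ discounted (r + β) α s := fun α hα s hs =>
    discounted_nonneg ((hmM s hs).1.le.trans (hα.2 s hs).1)
  have hle : ∀ α ∈ Adm T m M, ∀ s ∈ Icc 0 T,
      discounted (r + β) α s ≤ discounted (r + β) M s := fun α hα s hs =>
    discounted_mono (hα.2 s hs).2
  have m0 : (0:ℝ) ∈ Icc 0 T := ⟨le_rfl, hT.le⟩
  have mc : tc ∈ Icc 0 T := ⟨hc0, hcT⟩
  have ms : tstar ∈ Icc 0 T := ⟨hs0, hsT⟩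
  have mT : T ∈ Icc 0 T := ⟨hT.le, le_rfl⟩
  have hincr : ∀ α ∈ Adm T m M, ∀ s ∈ Icc 0 T, ∀ t ∈ Icc 0 T, s ≤ t →
      (∫ u in (0:ℝ)..s, discounted (r + β) α u) ≤ ∫ u in (0:ℝ)..t, discounted (r + β) α u := by
    intro α hα s hs t ht hst
    rw [← intervalIntegral.integral_add_adjacent_intervals (hdi α hα 0 m0 s hs) (hdi α hα s hs t ht)]
    have : 0 ≤ ∫ u in s..t, discounted (r + β) α u :=
      intervalIntegral.integral_nonneg hst fun u hu =>
        hpos α hα u ⟨hs.1.trans hu.1, hu.2.trans ht.2⟩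
    linarith
  have hleM : ∀ α ∈ Adm T m M, ∀ t ∈ Icc 0 T,
      (∫ u in (0:ℝ)..t, discounted (r + β) α u) ≤ ∫ u in (0:ℝ)..t, discounted (r + β) M u :=
    fun α hα t ht => intervalIntegral.integral_mono_on ht.1 (hdi α hα 0 m0 t ht)
      (hdi M hMA 0 m0 t ht) fun u hu => hle α hα u ⟨hu.1, hu.2.trans ht.2⟩
  have hrearr : ∀ α ∈ Adm T m M, ∀ a σ τ, 0 ≤ a → a ≤ σ → σ ≤ τ → τ ≤ T →
      h σ * ((∫ s in a..τ, discounted (r + β) α s) - ∫ s in a..σ, discounted (r + β) M s)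
        ≤ (∫ s in a..τ, h s * discounted (r + β) α s)
          - ∫ s in a..σ, h s * discounted (r + β) M s := by
    intro α hα a σ τ ha haσ hστ hτ
    have ma : a ∈ Icc 0 T := ⟨ha, haσ.trans (hστ.trans hτ)⟩
    have mτ : τ ∈ Icc 0 T := ⟨ha.trans (haσ.trans hστ), hτ⟩
    exact rearrangement_le haσ hστ hmon hcont (hdi α hα a ma τ mτ) (hdi M hMA a ma τ mτ)
      (fun s hs => hpos α hα s ⟨ha.trans hs.1, hs.2.trans hτ⟩)
      (fun s hs => hle α hα s ⟨ha.trans hs.1, hs.2.trans hτ⟩)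
  simp only [marginalCost_mul_discounted] at htstarEq
  rw [← hh] at htstarEq
  have hstar : (∫ s in (0:ℝ)..tc, h s * discounted (r + β) M s)
      + (∫ s in tc..T, h s * discounted (r + β) m s)
      = ∫ s in (0:ℝ)..tstar, h s * discounted (r + β) M s := by
    rw [← htstarEq, intervalIntegral.integral_add_adjacent_intervals
      (hhi M hMA 0 m0 tc mc) (hhi M hMA tc mc tstar ms)]
  have hV1 : ∀ α ∈ Adm T m M, (∫ s in (0:ℝ)..tstar, h s * discounted (r + β) M s)
      ≤ ∫ s in (0:ℝ)..T, h s * discounted (r + β) α s := fun α hα =>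
    hstar ▸ maxMin_le hβ hω0 hcT hmi hMi (hαi α hα) (fun t ht => (hα.2 t ht).1)
      (fun t ht => (hα.2 t ht).2)
  have hsum : ∀ w : ℝ → ℝ, Continuous w →
      (∫ s in (0:ℝ)..T, w s * discounted (r + β) (fun t => if t ≤ tc then M t else m t) s)
      = (∫ s in (0:ℝ)..tc, w s * discounted (r + β) M s)
        + ∫ s in tc..T, w s * discounted (r + β) m s := by
    intro w hw
    have hwi : ∀ s ∈ Icc 0 T, ∀ t ∈ Icc 0 T, IntervalIntegrable (fun s => w s *
        discounted (r + β) (fun t => if t ≤ tc then M t else m t) s) volume s t :=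
      fun s hs t ht => (hdi _ haA s hs t ht).continuousOn_mul hw.continuousOn
    rw [← intervalIntegral.integral_add_adjacent_intervals (hwi 0 m0 tc mc) (hwi tc mc T mT)]
    congr 1
    · refine intervalIntegral.integral_congr fun s hs => ?_
      rw [uIcc_of_le hc0] at hs
      simp only [discounted, if_pos hs.2]
    · refine intervalIntegral.integral_congr_ae (Filter.Eventually.of_forall fun s hs => ?_)
      rw [uIoc_of_le hcT] at hs
      simp only [discounted, if_neg hs.1.not_ge]
  have hopt : ∀ γ ∈ Adm T m M, (∀ α ∈ Adm T m M, costS r T ω γ (B γ) ≤ costS r T ω α (B α)) →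
      costS r T ω γ (B γ) = sInf ((fun α => costS r T ω α (B α)) '' Adm T m M) :=
    fun γ hγ hmin => (IsLeast.csInf_eq (s := (fun α => costS r T ω α (B α)) '' Adm T m M)
      ⟨⟨γ, hγ, rfl⟩, forall_mem_image.2 hmin⟩).symm
  refine ⟨fun hxs => ⟨haA, hopt _ haA ?_⟩, fun hxs => ⟨hMA, hopt _ hMA ?_⟩⟩
  · change (∫ s in (0:ℝ)..tstar, discounted (r + β) M s) < x at hxs
    have hspos : 0 < h tstar := marginalCost_pos hβ hω0 htstar.1
    have htot : (∫ s in (0:ℝ)..T,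
        discounted (r + β) (fun t => if t ≤ tc then M t else m t) s) < x := by
      have h1 := hrearr m hmA tc tstar T hc0 hcs hsT le_rfl
      rw [htstarEq, sub_self] at h1
      have h2 := nonpos_of_mul_nonpos_right h1 hspos
      have h3 := hsum (fun _ => 1) continuous_const
      simp only [one_mul] at h3
      have h4 := intervalIntegral.integral_add_adjacent_intervals
        (hdi M hMA 0 m0 tc mc) (hdi M hMA tc mc tstar ms)
      linarith
    have ha := hrepr _ haA
    have haT : tauS T (B fun t => if t ≤ tc then M t else m t) = T :=
      ha.eq_or.resolve_right fun h1 =>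
        absurd (hincr _ haA _ ha.mem T mT ha.mem.2) (by rw [h1]; exact htot.not_ge)
    intro α hα
    have hA := hrepr α hα
    have hcost := ha.cost
    rw [haT, ← hh, hsum h hcont, hstar] at hcost
    simp only [hcost, hA.cost]
    gcongr
    rcases hA.eq_or with h1 | h1
    · rw [h1]
      exact hV1 α hα
    · have hst : tstar ≤ tauS T (B α) := by
        by_contra! hlt
        have h2 := hleM α hα _ hA.mem
        have h3 := hincr M hMA _ hA.mem tstar ms hlt.le
        linarith
      have h2 := hrearr α hα 0 tstar _ le_rfl hs0 hst hA.mem.2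
      rw [h1] at h2
      have := mul_nonneg hspos.le (sub_nonneg.2 hxs.le)
      linarith
  · change x ≤ ∫ s in (0:ℝ)..tstar, discounted (r + β) M s at hxs
    have hR := hrepr M hMA
    have hστ := hR.le_of tstar ms hxs
    set σ := tauS T (B M) with hσ
    have hσx : (∫ s in (0:ℝ)..σ, discounted (r + β) M s) = x :=
      hR.eq_or.resolve_left (hστ.trans_lt htstar.2).ne
    intro α hα
    have hA := hrepr α hα
    simp only [hR.cost, hA.cost]
    gcongr
    have hle' : σ ≤ tauS T (B α) := by
      rcases hA.eq_or with h1 | h1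
      · rw [h1]
        exact hR.mem.2
      · exact hR.le_of _ hA.mem (h1 ▸ hleM α hα _ hA.mem)
    have h2 := hrearr α hα 0 σ _ le_rfl hR.mem.1 hle' hA.mem.2
    rw [hσx] at h2
    rcases hA.eq_or with h1 | h1
    · rcases lt_or_ge σ tc with hlt | hge
      · have := mul_nonneg_of_nonpos_of_nonpos (marginalCost_nonpos hβ hω0 hR.mem.1 hlt)
          (sub_nonpos.2 hA.le)
        linarith
      · rw [h1]
        refine le_trans ?_ (hV1 α hα)
        rw [← intervalIntegral.integral_add_adjacent_intervals
          (hhi M hMA 0 m0 σ hR.mem) (hhi M hMA σ hR.mem tstar ms)]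
        have : 0 ≤ ∫ s in σ..tstar, h s * discounted (r + β) M s :=
          intervalIntegral.integral_nonneg hστ fun u hu =>
            mul_nonneg (marginalCost_nonneg hβ hω0 (hge.trans hu.1))
              (hpos M hMA u ⟨hR.mem.1.trans hu.1, hu.2.trans hsT⟩)
        linarith
    · rw [h1, sub_self, mul_zero] at h2
      linarith
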